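/- Let R be a real invertible n×n matrix, written R = B_R · D_R where D_R is the diagonal matrix whose diagonal entries are the (positive) column norms of R, so the columns of B_R have unit Euclidean norm. Let ΔR be a real n×n matrix such that ‖ΔR(:,i)‖₂ ≤ ε ‖R(:,i)‖₂ for every column index i, for some ε ≥ 0. Then ‖ΔR R⁻¹‖ ≤ √n · ε · κ(B_R). -/

import Mathlib

open Matrix BigOperators

/-- Euclidean norm of a vector. -/
noncomputable def vnorm {k : ℕ} (v : Fin k → ℝ) : ℝ := Real.sqrt (∑ i, (v i)^2)

/-- Spectral norm (operator 2-norm) of a real matrix. -/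
noncomputable def spec {m n : ℕ} (A : Matrix (Fin m) (Fin n) ℝ) : ℝ :=
  ‖(Matrix.toEuclideanLin A).toContinuousLinearMap‖

/-- Moore–Penrose pseudoinverse of a full-column-rank matrix. -/
noncomputable def pinv {m n : ℕ} (A : Matrix (Fin m) (Fin n) ℝ) : Matrix (Fin n) (Fin m) ℝ :=
  (Aᵀ * A)⁻¹ * Aᵀ

/-- Condition number κ(B) = ‖B‖ ‖B†‖. -/
noncomputable def kappa {m n : ℕ} (B : Matrix (Fin m) (Fin n) ℝ) : ℝ :=
  spec B * spec (pinv B)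

lemma vnorm_eq_norm {k : ℕ} (v : Fin k → ℝ) : vnorm v = ‖WithLp.toLp 2 v‖ := by
  simp [vnorm, EuclideanSpace.norm_eq]

lemma vnorm_mul_right {k : ℕ} (v : Fin k → ℝ) (c : ℝ) :
    vnorm (fun j => v j * c) = vnorm v * |c| := by
  have h : (fun j => v j * c) = c • v := by ext j; simp [mul_comm]
  rw [h, vnorm_eq_norm, vnorm_eq_norm, WithLp.toLp_smul, norm_smul, Real.norm_eq_abs, mul_comm]

lemma spec_nonneg {m n : ℕ} (A : Matrix (Fin m) (Fin n) ℝ) : 0 ≤ spec A := norm_nonneg _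

open scoped Matrix.Norms.L2Operator in
lemma spec_mul_le {l m n : ℕ} (A : Matrix (Fin l) (Fin m) ℝ) (B : Matrix (Fin m) (Fin n) ℝ) :
    spec (A * B) ≤ spec A * spec B :=
  Matrix.l2_opNorm_mul A B

lemma vnorm_col_le_spec {m n : ℕ} (A : Matrix (Fin m) (Fin n) ℝ) (i : Fin n) :
    vnorm (fun k => A k i) ≤ spec A := by
  have h := (Matrix.toEuclideanLin A).toContinuousLinearMap.le_opNorm
    (EuclideanSpace.single i (1 : ℝ))
  rw [PiLp.norm_single, norm_one, mul_one] at h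
  refine le_trans (le_of_eq ?_) h
  rw [vnorm_eq_norm]
  congr 1
  ext k
  simp [Matrix.toLpLin_apply]

lemma sum_abs_le_sqrt_mul_norm {n : ℕ} (x : EuclideanSpace ℝ (Fin n)) :
    ∑ i, |x i| ≤ Real.sqrt n * ‖x‖ := by
  rw [EuclideanSpace.norm_eq, ← Real.sqrt_mul (Nat.cast_nonneg n)]
  refine Real.le_sqrt_of_sq_le ?_
  simpa using sq_sum_le_card_mul_sum_sq (s := Finset.univ) (f := fun i => |x i|)

lemma spec_le_of_vnorm_col_le {m n : ℕ} (A : Matrix (Fin m) (Fin n) ℝ) {c : ℝ} (hc : 0 ≤ c)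
    (h : ∀ i, vnorm (fun k => A k i) ≤ c) : spec A ≤ Real.sqrt n * c := by
  refine ContinuousLinearMap.opNorm_le_bound _ (by positivity) fun x => ?_
  have hx : (Matrix.toEuclideanLin A).toContinuousLinearMap x =
      ∑ i, x i • WithLp.toLp 2 (fun k => A k i) := by
    ext k
    simp [Matrix.toLpLin_apply, Matrix.mulVec, dotProduct, mul_comm]
  calc ‖(Matrix.toEuclideanLin A).toContinuousLinearMap x‖
      ≤ ∑ i, ‖x i • WithLp.toLp 2 (fun k => A k i)‖ := by rw [hx]; exact norm_sum_le _ _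
    _ ≤ ∑ i, |x i| * c := by
        refine Finset.sum_le_sum fun i _ => ?_
        rw [norm_smul, ← vnorm_eq_norm, Real.norm_eq_abs]
        exact mul_le_mul_of_nonneg_left (h i) (abs_nonneg _)
    _ = c * ∑ i, |x i| := by rw [← Finset.sum_mul, mul_comm]
    _ ≤ c * (Real.sqrt n * ‖x‖) := mul_le_mul_of_nonneg_left (sum_abs_le_sqrt_mul_norm x) hc
    _ = Real.sqrt n * c * ‖x‖ := by ring

/-- columnwise perturbation bound implies ‖ΔR R⁻¹‖ ≤ √n ε κ(B_R). -/
theorem stmt_15 {n : ℕ} (R BR ΔR : Matrix (Fin n) (Fin n) ℝ)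
    (hR : IsUnit R.det)
    (dR : Fin n → ℝ)
    (hdR : ∀ i, dR i = vnorm (fun k => R k i))
    (hdRpos : ∀ i, 0 < dR i)
    (hBR : R = BR * Matrix.diagonal dR)
    (ε : ℝ) (hε : 0 ≤ ε)
    (hΔR : ∀ i, vnorm (fun k => ΔR k i) ≤ ε * vnorm (fun k => R k i)) :
    spec (ΔR * R⁻¹) ≤ Real.sqrt n * ε * (spec BR * spec BR⁻¹) := by
  have hinv : R⁻¹ = Matrix.diagonal (fun i => (dR i)⁻¹) * BR⁻¹ := by
    have hD : (Matrix.diagonal dR)⁻¹ = Matrix.diagonal (fun i => (dR i)⁻¹) := by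
      refine Matrix.inv_eq_right_inv ?_
      rw [Matrix.diagonal_mul_diagonal, ← Matrix.diagonal_one]
      congr 1
      ext i
      exact mul_inv_cancel₀ (hdRpos i).ne'
    rw [hBR, Matrix.mul_inv_rev, hD]
  have hE : spec (ΔR * Matrix.diagonal (fun i => (dR i)⁻¹)) ≤ Real.sqrt n * ε := by
    refine spec_le_of_vnorm_col_le _ hε fun i => ?_
    simp only [Matrix.mul_diagonal]
    rw [vnorm_mul_right, abs_of_pos (inv_pos.mpr (hdRpos i)), ← div_eq_mul_inv,
      div_le_iff₀ (hdRpos i), hdR i]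
    exact hΔR i
  have hmul : spec (ΔR * R⁻¹) ≤ Real.sqrt n * ε * spec BR⁻¹ := by
    rw [hinv, ← Matrix.mul_assoc]
    exact (spec_mul_le _ _).trans (mul_le_mul_of_nonneg_right hE (spec_nonneg _))
  rcases Nat.eq_zero_or_pos n with hn | hn
  · subst hn
    simpa using hmul
  · have hB : 1 ≤ spec BR := by
      refine le_trans (le_of_eq ?_) (vnorm_col_le_spec BR ⟨0, hn⟩)
      have hcol := hdR ⟨0, hn⟩
      simp only [hBR, Matrix.mul_diagonal] at hcol
      rw [vnorm_mul_right, abs_of_pos (hdRpos _)] at hcol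
      exact mul_right_cancel₀ (hdRpos ⟨0, hn⟩).ne' (by rw [one_mul]; exact hcol)
    refine hmul.trans (mul_le_mul_of_nonneg_left ?_ (by positivity))
    exact le_mul_of_one_le_left (spec_nonneg _) hB
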